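/- Let r be a χ-distributed random variable with d degrees of freedom (d ≥ 1). Then √(d − 0.5) ≤ E r ≤ √d. -/

import Mathlib

open MeasureTheory ProbabilityTheory

/-- The standard Gaussian measure `N(0, I_d)` on `ℝ^d`. -/
noncomputable def stdGaussian (d : ℕ) : Measure (Fin d → ℝ) :=
  Measure.pi fun _ => gaussianReal 0 1

/-- The Euclidean norm of a vector in `ℝ^d`. -/
noncomputable def euclNorm {d : ℕ} (x : Fin d → ℝ) : ℝ :=
  Real.sqrt (∑ i, x i ^ 2)

namespace Real

lemma sq_Gamma_add_half_le {x : ℝ} (hx : 0 < x) :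
    (Gamma (x + 1 / 2) / Gamma x) ^ 2 ≤ x := by
  have hG : 0 < Gamma x := Gamma_pos_of_pos hx
  have h := Gamma_mul_add_mul_le_rpow_Gamma_mul_rpow_Gamma (s := x) (t := x + 1)
    (a := 1 / 2) (b := 1 / 2) hx (by linarith) (by norm_num) (by norm_num) (by norm_num)
  rw [show 1 / 2 * x + 1 / 2 * (x + 1) = x + 1 / 2 by ring, Gamma_add_one hx.ne',
    ← sqrt_eq_rpow, ← sqrt_eq_rpow, sqrt_mul hx.le, mul_left_comm,
    mul_self_sqrt hG.le] at h
  have h2 : Gamma (x + 1 / 2) / Gamma x ≤ √x := (div_le_iff₀ hG).2 h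
  have h0 : 0 < Gamma (x + 1 / 2) / Gamma x :=
    div_pos (Gamma_pos_of_pos (by linarith)) hG
  calc _ ≤ √x ^ 2 := by gcongr
    _ = x := sq_sqrt hx.le

lemma sq_div_add_half_le_sq_Gamma_add_half {x : ℝ} (hx : 0 < x) :
    x ^ 2 / (x + 1 / 2) ≤ (Gamma (x + 1 / 2) / Gamma x) ^ 2 := by
  have hG : 0 < Gamma x := Gamma_pos_of_pos hx
  have hG' : 0 < Gamma (x + 1 / 2) := Gamma_pos_of_pos (by linarith)
  have h := sq_Gamma_add_half_le (x := x + 1 / 2) (by linarith)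
  rw [show x + 1 / 2 + 1 / 2 = x + 1 by ring, Gamma_add_one hx.ne'] at h
  rw [div_pow, div_le_iff₀ (by positivity)] at h
  rw [div_pow, div_le_div_iff₀ (by linarith) (by positivity)]
  linarith

lemma sq_Gamma_add_half_add_one_le {x : ℝ} (hx : 1 / 4 < x) :
    (Gamma (x + 1 + 1 / 2) / Gamma (x + 1)) ^ 2 / (x + 1 - 1 / 4) ≤
      (Gamma (x + 1 / 2) / Gamma x) ^ 2 / (x - 1 / 4) := by
  have hx0 : 0 < x := by linarith
  have hG : 0 < Gamma x := Gamma_pos_of_pos hx0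
  rw [show x + 1 + 1 / 2 = x + 1 / 2 + 1 by ring, Gamma_add_one (by linarith : x + 1 / 2 ≠ 0),
    Gamma_add_one hx0.ne', mul_div_mul_comm, mul_pow,
    div_le_div_iff₀ (by linarith) (by linarith)]
  have key : ((x + 1 / 2) / x) ^ 2 * (x - 1 / 4) ≤ x + 1 - 1 / 4 := by
    rw [div_pow, div_mul_eq_mul_div, div_le_iff₀ (by positivity)]
    nlinarith
  nlinarith [mul_le_mul_of_nonneg_left key (sq_nonneg (Gamma (x + 1 / 2) / Gamma x))]

/-- Kershaw's inequality for the ratio of gamma values at distance one half. -/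
lemma sub_quarter_le_sq_Gamma_add_half {x : ℝ} (hx : 1 / 4 < x) :
    x - 1 / 4 ≤ (Gamma (x + 1 / 2) / Gamma x) ^ 2 := by
  set b : ℝ → ℝ := fun y ↦ (Gamma (y + 1 / 2) / Gamma y) ^ 2 / (y - 1 / 4) with hb
  have anti : ∀ n : ℕ, b (x + n) ≤ b x := by
    intro n
    induction n with
    | zero => simp
    | succ n ih =>
      refine le_trans ?_ ih
      have hn : (0 : ℝ) ≤ n := n.cast_nonneg
      have := sq_Gamma_add_half_add_one_le (x := x + n) (by linarith)
      simpa only [hb, Nat.cast_succ, ← add_assoc] using this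
  have lower : ∀ n : ℕ, 1 - 1 / (4 * (x + n)) ≤ b x := by
    intro n
    refine le_trans ?_ (anti n)
    have hn : (0 : ℝ) ≤ n := n.cast_nonneg
    have hy : 1 / 4 < x + n := by linarith
    generalize x + (n : ℝ) = y at hy
    refine le_trans ?_ (div_le_div_of_nonneg_right
      (sq_div_add_half_le_sq_Gamma_add_half (by linarith)) (by linarith))
    rw [div_div, le_div_iff₀ (mul_pos (by linarith) (by linarith)),
      one_sub_div (by linarith), div_mul_eq_mul_div, div_le_iff₀ (by linarith)]
    nlinarith
  have h1 : 1 ≤ b x := by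
    by_contra! h
    obtain ⟨n, hn⟩ := exists_nat_gt (1 / (1 - b x))
    have hl := lower n
    have hbx : 0 < 1 - b x := by linarith
    have hn0 : (0 : ℝ) < n := lt_trans (by positivity) hn
    rw [div_lt_iff₀ hbx] at hn
    have : 1 - b x ≤ 1 / (4 * (x + n)) := by linarith
    rw [le_div_iff₀ (by linarith)] at this
    nlinarith
  rwa [hb, one_le_div (by linarith)] at h1

end Real

lemma stdGaussian_eq_withDensity (d : ℕ) :
    _root_.stdGaussian d = (volume : Measure (Fin d → ℝ)).withDensity
      fun x ↦ ENNReal.ofReal (∏ i, gaussianPDFReal 0 1 (x i)) := by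
  refine Measure.pi_eq fun s hs ↦ ?_
  rw [withDensity_apply _ (.univ_pi hs), volume_pi, Measure.restrict_pi_pi,
    ← ofReal_integral_eq_lintegral_ofReal
      (Integrable.fintype_prod fun i ↦ (integrable_gaussianPDFReal 0 1).restrict)
      (ae_of_all _ fun x ↦ Finset.prod_nonneg fun i _ ↦ gaussianPDFReal_nonneg _ _ _),
    integral_fintype_prod_eq_prod, ENNReal.ofReal_prod_of_nonneg]
  · simp_rw [gaussianReal_apply_eq_integral _ one_ne_zero]
  · exact fun i _ ↦ integral_nonneg fun x ↦ gaussianPDFReal_nonneg _ _ _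

lemma prod_gaussianPDFReal_eq (d : ℕ) (x : Fin d → ℝ) :
    ∏ i, gaussianPDFReal 0 1 (x i) =
      (√(2 * Real.pi))⁻¹ ^ d * Real.exp (-(1 / 2) * euclNorm x ^ 2) := by
  simp only [gaussianPDFReal, Finset.prod_mul_distrib, ← Real.exp_sum, euclNorm]
  rw [Real.sq_sqrt (Finset.sum_nonneg fun i _ ↦ sq_nonneg _), Finset.mul_sum]
  simp only [Finset.prod_const, Finset.card_univ, Fintype.card_fin, NNReal.coe_one, mul_one,
    sub_zero]
  congr 3 with i
  ring

/-- Integration in polar coordinates of a radial function against the standard Gaussian measure. -/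
lemma exists_integral_euclNorm_stdGaussian (d : ℕ) (hd : 1 ≤ d) :
    ∃ c : ℝ, ∀ f : ℝ → ℝ, ∫ x, f (euclNorm x) ∂(_root_.stdGaussian d) =
      c * ∫ r in Set.Ioi (0 : ℝ), r ^ (d - 1) * (Real.exp (-(1 / 2) * r ^ 2) * f r) := by
  have : Nonempty (Fin d) := ⟨⟨0, hd⟩⟩
  refine ⟨(√(2 * Real.pi))⁻¹ ^ d * (d * (volume : Measure (EuclideanSpace ℝ (Fin d))).real
    (Metric.ball 0 1)), fun f ↦ ?_⟩
  have hmeas : Measurable fun x : Fin d → ℝ ↦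
      ENNReal.ofReal (∏ i, gaussianPDFReal 0 1 (x i)) :=
    (Finset.measurable_prod _ fun i _ ↦
      (measurable_gaussianPDFReal 0 1).comp (measurable_pi_apply i)).ennreal_ofReal
  have hpolar := integral_fun_norm_addHaar (volume : Measure (EuclideanSpace ℝ (Fin d)))
    fun r ↦ Real.exp (-(1 / 2) * r ^ 2) * f r
  have hnorm : ∀ x : EuclideanSpace ℝ (Fin d), ‖x‖ = euclNorm (WithLp.ofLp x) := fun x ↦ by
    simp [EuclideanSpace.norm_eq, euclNorm]
  simp only [hnorm, finrank_euclideanSpace_fin, nsmul_eq_mul, smul_eq_mul] at hpolar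
  have hcomp := (EuclideanSpace.volume_preserving_symm_measurableEquiv_toLp (Fin d)).integral_comp'
    (fun x ↦ Real.exp (-(1 / 2) * euclNorm x ^ 2) * f (euclNorm x))
  rw [mul_assoc, mul_assoc, hpolar.symm.trans hcomp, stdGaussian_eq_withDensity,
    integral_withDensity_eq_integral_toReal_smul hmeas (ae_of_all _ fun _ ↦ ENNReal.ofReal_lt_top),
    ← integral_const_mul]
  refine integral_congr_ae (ae_of_all _ fun x ↦ ?_)
  have h0 : 0 ≤ ∏ i, gaussianPDFReal 0 1 (x i) :=
    Finset.prod_nonneg fun i _ ↦ gaussianPDFReal_nonneg _ _ _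
  simp only [ENNReal.toReal_ofReal h0, smul_eq_mul]
  rw [prod_gaussianPDFReal_eq, mul_assoc]

lemma integral_Ioi_pow_mul_exp_neg_half_sq (k : ℕ) :
    ∫ r in Set.Ioi (0 : ℝ), r ^ k * Real.exp (-(1 / 2) * r ^ 2) =
      √2 ^ (k + 1) / 2 * Real.Gamma ((k + 1) / 2) := by
  have h := integral_rpow_mul_exp_neg_mul_rpow (p := 2) (q := k) (b := 1 / 2) two_pos
    (by linarith [(k.cast_nonneg : (0 : ℝ) ≤ k)]) (by norm_num)
  simp only [Real.rpow_natCast, Real.rpow_two] at h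
  rw [h, one_div, Real.inv_rpow two_pos.le, ← Real.rpow_neg two_pos.le, Real.sqrt_eq_rpow,
    ← Real.rpow_mul_natCast two_pos.le]
  push_cast
  ring_nf

/-- The mean of the chi distribution. -/
lemma integral_euclNorm_stdGaussian (d : ℕ) (hd : 1 ≤ d) :
    ∫ x, euclNorm x ∂(_root_.stdGaussian d) =
      √2 * (Real.Gamma ((d : ℝ) / 2 + 1 / 2) / Real.Gamma ((d : ℝ) / 2)) := by
  obtain ⟨c, hc⟩ := exists_integral_euclNorm_stdGaussian d hd
  have : IsProbabilityMeasure (_root_.stdGaussian d) := by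
    unfold _root_.stdGaussian; infer_instance
  obtain ⟨k, rfl⟩ := Nat.exists_eq_add_of_le' hd
  have h1 := hc fun _ ↦ 1
  have h2 := hc fun r ↦ r
  have hpow : ∀ r : ℝ, r ^ k * (Real.exp (-(1 / 2) * r ^ 2) * r) =
      r ^ (k + 1) * Real.exp (-(1 / 2) * r ^ 2) := fun r ↦ by ring
  simp only [Nat.add_sub_cancel, mul_one, integral_const, probReal_univ, smul_eq_mul,
    hpow, integral_Ioi_pow_mul_exp_neg_half_sq] at h1 h2
  have hG : 0 < Real.Gamma (((k : ℝ) + 1) / 2) := Real.Gamma_pos_of_pos (by positivity)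
  rw [h2, Nat.cast_succ, ← add_div, mul_div_assoc', eq_div_iff hG.ne']
  rw [pow_succ √2 (k + 1)]
  linear_combination (-√2 * Real.Gamma (((k : ℝ) + 1 + 1) / 2)) * h1

/-- Let `r` be a `χ`-distributed random variable with `d ≥ 1`
degrees of freedom, i.e. the norm of a standard Gaussian vector in `ℝ^d`.
Then `√(d − 0.5) ≤ E r ≤ √d`. -/
theorem chi_mean_bounds (d : ℕ) (hd : 1 ≤ d) :
    Real.sqrt ((d : ℝ) - 0.5) ≤ (∫ x, euclNorm x ∂(stdGaussian d)) ∧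
    (∫ x, euclNorm x ∂(stdGaussian d)) ≤ Real.sqrt d := by
  have hd' : (1 : ℝ) ≤ d := by exact_mod_cast hd
  have hpos : 0 < Real.Gamma ((d : ℝ) / 2 + 1 / 2) / Real.Gamma ((d : ℝ) / 2) :=
    div_pos (Real.Gamma_pos_of_pos (by positivity)) (Real.Gamma_pos_of_pos (by positivity))
  have hlow := Real.sub_quarter_le_sq_Gamma_add_half (x := (d : ℝ) / 2) (by linarith)
  have hupp := Real.sq_Gamma_add_half_le (x := (d : ℝ) / 2) (by linarith)
  rw [integral_euclNorm_stdGaussian d hd]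
  constructor
  · refine Real.sqrt_le_iff.2 ⟨by positivity, ?_⟩
    rw [mul_pow, Real.sq_sqrt two_pos.le]
    linarith
  · refine Real.le_sqrt_of_sq_le ?_
    rw [mul_pow, Real.sq_sqrt two_pos.le]
    linarith
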